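/- Let q, v, K be natural numbers with 2v ≤ q, and let U_1, ..., U_K and V_1, ..., V_K be finite subsets of some universe such that |U_i| + |V_i| ≤ q and |V_i| ≤ v for every i, and such that U_i ∩ V_j is not a subset of V_i for every pair i ≠ j. Then K ≤ C(q, v). -/

import Mathlib

/-- Choose is monotone in the lower index below the half. -/
lemma clv_choose_mono (q v b : ℕ) (hv : 2 * v ≤ q) (hb : b ≤ v) : q.choose b ≤ q.choose v := by
  induction v, hb using Nat.le_induction with
  | base => exact le_rfl
  | succ m hm ih =>
    exact (ih (by omega)).trans (Nat.choose_le_succ_of_lt_half_left (by omega))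

/-- Arithmetic identity for the inductive step. -/
lemma clv_arith (a b : ℕ) :
    ((b : ℚ) + 1) * (1 / ((a + b).choose b : ℚ))
      = ((a : ℚ) + b + 1) * (1 / ((a + (b + 1)).choose (b + 1) : ℚ)) := by
  have h := Nat.add_one_mul_choose_eq (a + b) b
  have h1 : (0 : ℚ) < ((a + b).choose b : ℚ) := by
    exact_mod_cast Nat.choose_pos (by omega)
  have h2 : (0 : ℚ) < ((a + (b + 1)).choose (b + 1) : ℚ) := by
    exact_mod_cast Nat.choose_pos (by omega)
  have h' : ((a : ℚ) + b + 1) * ((a + b).choose b : ℚ)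
      = ((a + (b + 1)).choose (b + 1) : ℚ) * (b + 1) := by
    exact_mod_cast h
  field_simp
  linarith

/-- The Bollobas set pairs inequality. -/
lemma clv_bollobas {α ι : Type*} [DecidableEq α] [DecidableEq ι] (n : ℕ) :
    ∀ (X : Finset α) (s : Finset ι) (A B : ι → Finset α), X.card = n →
      (∀ i ∈ s, A i ⊆ X) → (∀ i ∈ s, B i ⊆ X) → (∀ i ∈ s, Disjoint (A i) (B i)) →
      (∀ i ∈ s, ∀ j ∈ s, i ≠ j → ¬ Disjoint (A i) (B j)) →
      ∑ i ∈ s, (1 / (((A i).card + (B i).card).choose (B i).card : ℚ)) ≤ 1 := by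
  induction n with
  | zero =>
    intro X s A B hX hA hB hd hc
    have hX' : X = ∅ := Finset.card_eq_zero.mp hX
    subst hX'
    have hs : s.card ≤ 1 := by
      rw [Finset.card_le_one]
      intro i hi j hj
      by_contra hij
      apply hc i hi j hj hij
      rw [Finset.subset_empty.mp (hB j hj)]
      exact Finset.disjoint_empty_right _
    calc _ = ∑ i ∈ s, (1 : ℚ) := by
          apply Finset.sum_congr rfl
          intro i hi
          rw [Finset.subset_empty.mp (hB i hi)]
          simp
      _ ≤ 1 := by simpa using hs
  | succ n ih =>
    intro X s A B hX hA hB hd hc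
    by_cases hne : ∃ k ∈ s, B k = ∅
    · obtain ⟨k, hk, hBk⟩ := hne
      have hs : s = {k} := by
        ext i
        rw [Finset.mem_singleton]
        constructor
        · intro hi
          by_contra hik
          apply hc i hi k hk hik
          rw [hBk]
          exact Finset.disjoint_empty_right _
        · rintro rfl
          exact hk
      rw [hs]
      simp [hBk]
    · push Not at hne
      have key : ∀ x ∈ X, ∑ i ∈ s, (if x ∈ A i then (0 : ℚ) else
          (1 / (((A i).card + ((B i).erase x).card).choose ((B i).erase x).card : ℚ))) ≤ 1 := by
        intro x hx
        have := ih (X.erase x) (s.filter (fun i => x ∉ A i)) A (fun i => (B i).erase x)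
          (by rw [Finset.card_erase_of_mem hx, hX]; rfl)
          (by
            intro i hi
            rw [Finset.mem_filter] at hi
            exact Finset.subset_erase.mpr ⟨hA i hi.1, hi.2⟩)
          (by
            intro i hi
            rw [Finset.mem_filter] at hi
            exact Finset.erase_subset_erase _ (hB i hi.1))
          (by
            intro i hi
            rw [Finset.mem_filter] at hi
            exact (hd i hi.1).mono_right (Finset.erase_subset _ _))
          (by
            intro i hi j hj hij
            rw [Finset.mem_filter] at hi hj
            have h := hc i hi.1 j hj.1 hij
            rw [Finset.not_disjoint_iff] at h ⊢
            obtain ⟨y, hy1, hy2⟩ := h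
            refine ⟨y, hy1, Finset.mem_erase.mpr ⟨?_, hy2⟩⟩
            rintro rfl
            exact hi.2 hy1)
        rw [Finset.sum_filter] at this
        simpa only [ite_not] using this
      have tot := Finset.sum_le_sum key
      rw [Finset.sum_comm] at tot
      have inner : ∀ i ∈ s, ∑ x ∈ X, (if x ∈ A i then (0 : ℚ) else
          (1 / (((A i).card + ((B i).erase x).card).choose ((B i).erase x).card : ℚ)))
          = ((n : ℚ) + 1) * (1 / (((A i).card + (B i).card).choose (B i).card : ℚ)) := by
        intro i hi
        obtain ⟨b, hb⟩ : ∃ b, (B i).card = b + 1 :=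
          ⟨(B i).card - 1, by have := Finset.card_pos.mpr (hne i hi); omega⟩
        have hBX : B i ⊆ X \ A i := by
          rw [Finset.subset_sdiff]
          exact ⟨hB i hi, (hd i hi).symm⟩
        have e1 : (((X \ A i) \ B i).card : ℚ) = (n + 1) - (A i).card - (b + 1) := by
          have h1 := Finset.card_sdiff_add_card_eq_card hBX
          have h2 := Finset.card_sdiff_add_card_eq_card (hA i hi)
          have h3 : ((X \ A i) \ B i).card + (b + 1) + (A i).card = n + 1 := by omega
          have h4 : (((X \ A i) \ B i).card : ℚ) + (b + 1) + (A i).card = n + 1 := by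
            exact_mod_cast h3
          linarith
        have e2 : ∑ x ∈ X, (if x ∈ A i then (0 : ℚ) else
          (1 / (((A i).card + ((B i).erase x).card).choose ((B i).erase x).card : ℚ)))
          = ∑ x ∈ X \ A i,
          (1 / (((A i).card + ((B i).erase x).card).choose ((B i).erase x).card : ℚ)) := by
          rw [Finset.sdiff_eq_filter, Finset.sum_filter]
          simp only [ite_not]
        rw [e2, ← Finset.sum_sdiff hBX]
        have e3 : ∑ x ∈ (X \ A i) \ B i,
          (1 / (((A i).card + ((B i).erase x).card).choose ((B i).erase x).card : ℚ))
          = ∑ x ∈ (X \ A i) \ B i,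
            (1 / (((A i).card + (b + 1)).choose (b + 1) : ℚ)) := by
          apply Finset.sum_congr rfl
          intro x hx
          rw [Finset.erase_eq_of_notMem (Finset.mem_sdiff.mp hx).2, hb]
        have e4 : ∑ x ∈ B i,
          (1 / (((A i).card + ((B i).erase x).card).choose ((B i).erase x).card : ℚ))
          = ∑ x ∈ B i, (1 / (((A i).card + b).choose b : ℚ)) := by
          apply Finset.sum_congr rfl
          intro x hx
          rw [Finset.card_erase_of_mem hx, hb]
          rfl
        rw [e3, e4, Finset.sum_const, Finset.sum_const, nsmul_eq_mul, nsmul_eq_mul, e1, hb]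
        have := clv_arith (A i).card b
        push_cast
        rw [this]
        ring
      rw [Finset.sum_congr rfl inner, ← Finset.mul_sum] at tot
      simp only [Finset.sum_const, hX, nsmul_eq_mul, mul_one] at tot
      have hpos : (0 : ℚ) < (n : ℚ) + 1 := by positivity
      push_cast at tot
      nlinarith

/-- Generalized combinatorial lemma with a bound `v ≤ q/2` on the sizes of the `V i`. -/
theorem combinatorial_lemma_verifier {α : Type*} [DecidableEq α] (q v K : ℕ)
    (hv : 2 * v ≤ q)
    (U V : Fin K → Finset α)
    (hcard : ∀ i, (U i).card + (V i).card ≤ q)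
    (hVcard : ∀ i, (V i).card ≤ v)
    (hnsub : ∀ i j, i ≠ j → ¬ (U i ∩ V j ⊆ V i)) :
    K ≤ q.choose v := by
  have hB := clv_bollobas _ (Finset.univ.biUnion (fun i => U i ∪ V i)) Finset.univ
    (fun i => U i \ V i) V rfl
    (fun i _ => (Finset.sdiff_subset.trans Finset.subset_union_left).trans
      (Finset.subset_biUnion_of_mem (fun i => U i ∪ V i) (Finset.mem_univ i)))
    (fun i _ => Finset.subset_union_right.trans
      (Finset.subset_biUnion_of_mem (fun i => U i ∪ V i) (Finset.mem_univ i)))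
    (fun i _ => Finset.sdiff_disjoint)
    (by
      intro i _ j _ hij
      obtain ⟨x, hx, hx'⟩ := Finset.not_subset.mp (hnsub i j hij)
      rw [Finset.mem_inter] at hx
      exact Finset.not_disjoint_iff.mpr ⟨x, Finset.mem_sdiff.mpr ⟨hx.1, hx'⟩, hx.2⟩)
  have hpos : (0 : ℚ) < (q.choose v : ℚ) := by
    exact_mod_cast Nat.choose_pos (by omega)
  have hle : ∑ i : Fin K, (1 / (q.choose v : ℚ)) ≤ 1 := by
    refine le_trans (Finset.sum_le_sum ?_) hB
    intro i _
    apply one_div_le_one_div_of_le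
    · exact_mod_cast Nat.choose_pos (by omega)
    · have h1 : (U i \ V i).card ≤ (U i).card := Finset.card_le_card Finset.sdiff_subset
      have h2 := hcard i
      exact_mod_cast (Nat.choose_le_choose (V i).card (by omega)).trans
        (clv_choose_mono q v _ hv (hVcard i))
  rw [Finset.sum_const, Finset.card_univ, Fintype.card_fin, nsmul_eq_mul, mul_one_div,
    div_le_one hpos] at hle
  exact_mod_cast hle
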